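/- An affine MV polytope P is a δ-top polytope (a_k = ā_k = 0 for all k ≥ 2, with partitions λ, λ̄ arbitrary) if and only if there exist t ≥ 0, integers k_1 ≥ k_2 ≥ ⋯ ≥ k_t > 0 and indices i_1, …, i_t ∈ ℤ/2ℤ with i_{j+1} = i_j + 1, such that P = f_{i_1}^{k_1} f_{i_2}^{k_2} ⋯ f_{i_t}^{k_t}(P_0), where P_0 is the trivial MV polytope; that is, there are MV polytopes Q_t = P_0, Q_{t−1}, …, Q_0 = P with Q_{j−1} = f_{i_j}^{k_j}(Q_j) for each 1 ≤ j ≤ t. -/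

import Mathlib

namespace MVPaper

/-- The lattice `L = ℤα₀ ⊕ ℤα₁`, a vector `(x, y)` standing for `xα₀ + yα₁`;
`(v, ω₀) = x` is the first coordinate and `(v, ω₁) = y` the second. -/
abbrev LatL := ℤ × ℤ

def alpha0 : LatL := (1, 0)
def alpha1 : LatL := (0, 1)
def deltaL : LatL := (1, 1)

/-- A Lusztig datum: a finitely supported sequence `(a_k)_{k≥1}` (here `a k = a_{k+1}`),
a partition `lam` (a multiset of positive integers), and a finitely supported sequence
`(a^k)_{k≥1}` (here `A k = a^{k+1}`). -/
structure LusztigDatum where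
  a : ℕ →₀ ℕ
  lam : Multiset ℕ
  A : ℕ →₀ ℕ
  lam_pos : ∀ x ∈ lam, 0 < x

namespace LusztigDatum

/-- The lower vertex `μ_k = ∑_{j=1}^k a_j (sroot + (j−1)δ)`. -/
def muLow (d : LusztigDatum) (sroot : LatL) (k : ℕ) : LatL :=
  ∑ j ∈ Finset.range k, (d.a j) • (sroot + j • deltaL)

/-- The vertex `μ_∞`. -/
def muInf (d : LusztigDatum) (sroot : LatL) : LatL :=
  d.a.sum fun j m => m • (sroot + j • deltaL)

/-- The vertex `μ^∞ = μ_∞ + |λ|δ`. -/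
def muTopInf (d : LusztigDatum) (sroot : LatL) : LatL :=
  d.muInf sroot + (d.lam.sum) • deltaL

/-- The upper vertex `μ^k = μ^∞ + ∑_{j>k} a^j (oroot + (j−1)δ)`. -/
def muHigh (d : LusztigDatum) (sroot oroot : LatL) (k : ℕ) : LatL :=
  d.muTopInf sroot + ∑ j ∈ d.A.support.filter (fun j => k ≤ j), (d.A j) • (oroot + j • deltaL)

end LusztigDatum

/-- An affine `sl₂` MV polytope: a pair of Lusztig data (right datum `R`, left datum `L`)
of the same weight, satisfying the conditions (i)–(iv) of
Baumann–Dunlap–Kamnitzer–Tingley. -/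
structure MVPolytope where
  R : LusztigDatum
  L : LusztigDatum
  closing : R.muHigh alpha1 alpha0 0 = L.muHigh alpha0 alpha1 0
  cond_low : ∀ k : ℕ, 2 ≤ k →
    (L.muLow alpha0 k - R.muLow alpha1 (k - 1)).2 ≤ 0 ∧
    (R.muLow alpha1 k - L.muLow alpha0 (k - 1)).1 ≤ 0 ∧
    ((L.muLow alpha0 k - R.muLow alpha1 (k - 1)).2 = 0 ∨
      (R.muLow alpha1 k - L.muLow alpha0 (k - 1)).1 = 0)
  cond_high : ∀ k : ℕ, 2 ≤ k →
    0 ≤ (L.muHigh alpha0 alpha1 k - R.muHigh alpha1 alpha0 (k - 1)).1 ∧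
    0 ≤ (R.muHigh alpha1 alpha0 k - L.muHigh alpha0 alpha1 (k - 1)).2 ∧
    ((L.muHigh alpha0 alpha1 k - R.muHigh alpha1 alpha0 (k - 1)).1 = 0 ∨
      (R.muHigh alpha1 alpha0 k - L.muHigh alpha0 alpha1 (k - 1)).2 = 0)
  cond_parts :
    (if (R.muInf alpha1 - L.muInf alpha0).1 * (R.muTopInf alpha1 - L.muTopInf alpha0).2
        = (R.muInf alpha1 - L.muInf alpha0).2 * (R.muTopInf alpha1 - L.muTopInf alpha0).1
     then R.lam = L.lam
     else ∃ n : ℕ,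
        (n : ℤ) = (R.muInf alpha1 - L.muInf alpha0).2 - (R.muInf alpha1 - L.muInf alpha0).1 ∧
        (R.lam = n ::ₘ L.lam ∨ L.lam = n ::ₘ R.lam))
  cond_size : ∀ x : ℕ, (x ∈ R.lam ∨ x ∈ L.lam) →
    (x : ℤ) ≤ (R.muInf alpha1 - L.muInf alpha0).2 - (R.muInf alpha1 - L.muInf alpha0).1

/-- `MVf i n P Q` says `Q = f_i^n(P)`: for `i = 1` the right datum of `Q` is that of `P`
with `a_1` increased by `n`; for `i = 0` the left datum of `Q` is that of `P` with `ā_1`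
increased by `n` (the other datum is then determined, by BDKT Theorem 3.11). -/
def MVf (i : ZMod 2) (n : ℕ) (P Q : MVPolytope) : Prop :=
  if i = 1 then
    Q.R.a = P.R.a + Finsupp.single 0 n ∧ Q.R.lam = P.R.lam ∧ Q.R.A = P.R.A
  else
    Q.L.a = P.L.a + Finsupp.single 0 n ∧ Q.L.lam = P.L.lam ∧ Q.L.A = P.L.A

/-- The trivial (highest weight) MV polytope: all data vanish. -/
def IsTrivialMV (P : MVPolytope) : Prop :=
  P.R.a = 0 ∧ P.R.lam = 0 ∧ P.R.A = 0 ∧ P.L.a = 0 ∧ P.L.lam = 0 ∧ P.L.A = 0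

/-- A top polytope: `λ = λ̄ = ∅` and `a_k = ā_k = 0` for all `k ≥ 2`. -/
def IsTopMV (P : MVPolytope) : Prop :=
  P.R.lam = 0 ∧ P.L.lam = 0 ∧ (∀ k, 1 ≤ k → P.R.a k = 0) ∧ (∀ k, 1 ≤ k → P.L.a k = 0)

/-- A δ-top polytope: `a_k = ā_k = 0` for all `k ≥ 2`. -/
def IsDeltaTopMV (P : MVPolytope) : Prop :=
  (∀ k, 1 ≤ k → P.R.a k = 0) ∧ (∀ k, 1 ≤ k → P.L.a k = 0)

/-- `P = f_{i_0}^{k_0} ⋯ f_{i_{t-1}}^{k_{t-1}}(P₀)` with `P₀` the trivial MV polytope: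
a chain `Q t = P₀, …, Q 0 = P` with `Q j = f_{i_j}^{k_j}(Q (j+1))`. -/
def FWordChain (t : ℕ) (k : ℕ → ℕ) (i : ℕ → ZMod 2) (P : MVPolytope) : Prop :=
  ∃ Q : ℕ → MVPolytope, IsTrivialMV (Q t) ∧ Q 0 = P ∧
    ∀ j, j < t → MVf (i j) (k j) (Q (j + 1)) (Q j)


/-! ### Support functions -/

/-- Support function `E n = ∑_{i<n} (n - i) a_i` of a sequence. -/
def EE (a : ℕ →₀ ℕ) (n : ℕ) : ℤ := ∑ i ∈ Finset.range n, ((n : ℤ) - i) * (a i : ℤ)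

def SS (a : ℕ →₀ ℕ) : ℤ := a.sum fun _ m => (m : ℤ)

def QQ (a : ℕ →₀ ℕ) : ℤ := a.sum fun j m => (j : ℤ) * (m : ℤ)

theorem EE_zero (a : ℕ →₀ ℕ) : EE a 0 = 0 := by simp [EE]

theorem EE_one (a : ℕ →₀ ℕ) : EE a 1 = a 0 := by simp [EE]

theorem EE_succ (a : ℕ →₀ ℕ) (n : ℕ) :
    EE a (n + 1) = EE a n + ∑ i ∈ Finset.range (n + 1), (a i : ℤ) := by
  unfold EE
  rw [Finset.sum_range_succ, Finset.sum_range_succ, ← add_assoc, ← Finset.sum_add_distrib]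
  congr 1
  · apply Finset.sum_congr rfl
    intro i _
    push_cast
    ring
  · push_cast
    ring

theorem EE_succ_succ (a : ℕ →₀ ℕ) (n : ℕ) :
    EE a (n + 2) = 2 * EE a (n + 1) - EE a n + a (n + 1) := by
  have h1 := EE_succ a n
  have h2 := EE_succ a (n + 1)
  rw [Finset.sum_range_succ] at h2
  linarith

theorem SS_nonneg (a : ℕ →₀ ℕ) : 0 ≤ SS a :=
  Finset.sum_nonneg fun _ _ => by positivity

theorem QQ_nonneg (a : ℕ →₀ ℕ) : 0 ≤ QQ a :=
  Finset.sum_nonneg fun _ _ => by positivity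

theorem support_bound (a : ℕ →₀ ℕ) : ∃ N, ∀ n, N ≤ n → a n = 0 := by
  refine ⟨a.support.sup id + 1, fun n hn => ?_⟩
  by_contra h
  have : n ≤ a.support.sup id := Finset.le_sup (f := id) (Finsupp.mem_support_iff.mpr h)
  omega

theorem sum_range_eq (a : ℕ →₀ ℕ) (N n : ℕ) (h : ∀ n, N ≤ n → a n = 0) (hn : N ≤ n)
    {M : Type*} [AddCommMonoid M] (f : ℕ → ℕ → M) (hf : ∀ i, f i 0 = 0) :
    ∑ i ∈ Finset.range n, f i (a i) = a.sum f := by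
  rw [Finsupp.sum_of_support_subset a (s := Finset.range n) _ f (fun i _ => hf i)]
  intro i hi
  rw [Finset.mem_range]
  by_contra hc
  exact (Finsupp.mem_support_iff.mp hi) (h i (by omega))

theorem EE_large (a : ℕ →₀ ℕ) : ∃ N, ∀ n, N ≤ n → EE a n = n * SS a - QQ a := by
  obtain ⟨N, hN⟩ := support_bound a
  refine ⟨N, fun n hn => ?_⟩
  unfold SS QQ
  rw [← sum_range_eq a N n hN hn (fun _ m => (m : ℤ)) (by simp),
    ← sum_range_eq a N n hN hn (fun j m => (j : ℤ) * (m : ℤ)) (by simp), Finset.mul_sum,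
    ← Finset.sum_sub_distrib]
  apply Finset.sum_congr rfl
  intro i _
  ring

theorem EE_inj {a b : ℕ →₀ ℕ} (h : ∀ n, EE a n = EE b n) : a = b := by
  ext n
  cases n with
  | zero =>
    have := h 1
    rw [EE_one, EE_one] at this
    exact_mod_cast this
  | succ n =>
    have h0 := h n
    have h1 := h (n + 1)
    have h2 := h (n + 2)
    rw [EE_succ_succ, EE_succ_succ] at h2
    have : (a (n + 1) : ℤ) = b (n + 1) := by linarith
    exact_mod_cast this

theorem EE_of_convex (h : ℕ → ℤ) (h0 : h 0 = 0) (h1 : 0 ≤ h 1)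
    (hc : ∀ i, 0 ≤ h (i + 2) - 2 * h (i + 1) + h i) (T c : ℤ) (N : ℕ)
    (hl : ∀ n, N ≤ n → h n = n * T - c) :
    ∃ b : ℕ →₀ ℕ, (∀ n, EE b n = h n) ∧ SS b = T ∧ QQ b = c := by
  let f : ℕ → ℕ := fun n => match n with
    | 0 => (h 1).toNat
    | n + 1 => (h (n + 2) - 2 * h (n + 1) + h n).toNat
  have hf : ∀ n, f n ≠ 0 → n ∈ Finset.range (N + 1) := by
    intro n hn
    rw [Finset.mem_range]
    by_contra hcon
    apply hn
    obtain ⟨m, rfl⟩ : ∃ m, n = m + 1 := ⟨n - 1, by omega⟩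
    show (h (m + 2) - 2 * h (m + 1) + h m).toNat = 0
    rw [hl m (by omega), hl (m + 1) (by omega), hl (m + 2) (by omega)]
    push_cast
    ring_nf
    rfl
  let b : ℕ →₀ ℕ := Finsupp.onFinset (Finset.range (N + 1)) f hf
  have hb : ∀ n, EE b n = h n ∧ EE b (n + 1) = h (n + 1) := by
    intro n
    induction n with
    | zero =>
      refine ⟨by rw [EE_zero, h0], ?_⟩
      rw [EE_one]
      show ((h 1).toNat : ℤ) = h 1
      exact Int.toNat_of_nonneg h1
    | succ n ih =>
      refine ⟨ih.2, ?_⟩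
      rw [EE_succ_succ, ih.1, ih.2]
      have : ((b (n + 1) : ℕ) : ℤ) = h (n + 2) - 2 * h (n + 1) + h n :=
        Int.toNat_of_nonneg (hc n)
      rw [this]
      ring
  obtain ⟨N', hN'⟩ := EE_large b
  have e1 := hN' (N + N') (by omega)
  have e2 := hN' (N + N' + 1) (by omega)
  rw [(hb _).1, hl _ (by omega)] at e1 e2
  push_cast at e1 e2
  have hS : SS b = T := by linarith
  refine ⟨b, fun n => (hb n).1, hS, ?_⟩
  rw [hS] at e1
  linarith

/-! ### Compatibility -/

def CX (θ η : ℕ → ℤ) (n : ℕ) : Prop :=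
  ((n : ℤ) + 2) * (η n - θ (n + 1)) ≤ (n + 1) * (η (n + 1) - θ (n + 2))
def EX (θ η : ℕ → ℤ) (n : ℕ) : Prop :=
  ((n : ℤ) + 2) * (η n - θ (n + 1)) = (n + 1) * (η (n + 1) - θ (n + 2))
def CY (θ η : ℕ → ℤ) (n : ℕ) : Prop :=
  ((n : ℤ) + 2) * (θ n - η (n + 1)) ≤ (n + 1) * (θ (n + 1) - η (n + 2))
def EY (θ η : ℕ → ℤ) (n : ℕ) : Prop :=
  ((n : ℤ) + 2) * (θ n - η (n + 1)) = (n + 1) * (θ (n + 1) - η (n + 2))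

def Compat (θ η : ℕ → ℤ) : Prop :=
  ∀ n, CX θ η n ∧ CY θ η n ∧ (EX θ η n ∨ EY θ η n)

theorem Compat.symm {θ η : ℕ → ℤ} (h : Compat θ η) : Compat η θ := fun n =>
  ⟨(h n).2.1, (h n).1, (h n).2.2.symm⟩

/-- The comparison argument. -/
theorem compare_step {θ η η' : ℕ → ℤ} (h : Compat θ η) (h' : Compat θ η') (n : ℕ)
    (h0 : η n = η' n) (h1 : η (n + 1) < η' (n + 1)) (k : ℕ) :
    η (n + k + 1) < η' (n + k + 1) ∧ EY θ η' (n + k) ∧ ¬ EX θ η' (n + k) ∧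
      η' (n + k) - η (n + k) < η' (n + k + 1) - η (n + k + 1) ∧
      ((n + k : ℕ) + 2 : ℤ) * (η' (n + k) - η (n + k)) <
        ((n + k : ℕ) + 1) * (η' (n + k + 1) - η (n + k + 1)) := by
  have key : ∀ m : ℕ, η (m + 1) < η' (m + 1) →
      ((m : ℤ) + 2) * (η' m - η m) < (m + 1) * (η' (m + 1) - η (m + 1)) →
      EY θ η' m ∧ ¬ EX θ η' m := by
    intro m _ hm
    have hX := (h m).1
    have : ¬ EX θ η' m := by
      unfold EX CX at *
      intro he
      nlinarith
    exact ⟨(h' m).2.2.resolve_left this, this⟩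
  induction k with
  | zero =>
    have hlt : ((n : ℤ) + 2) * (η' n - η n) < (n + 1) * (η' (n + 1) - η (n + 1)) := by
      rw [h0, sub_self, mul_zero]
      apply mul_pos <;> [positivity; linarith]
    obtain ⟨k1, k2⟩ := key n h1 hlt
    refine ⟨h1, k1, k2, ?_, ?_⟩
    · simp only [add_zero]; linarith
    · simpa using hlt
  | succ k ih =>
    obtain ⟨i1, i2, i3, i4, i5⟩ := ih
    generalize hm : n + k = m at *
    have e1 : n + (k + 1) = m + 1 := by omega
    rw [e1]
    have hY := (h m).2.1
    unfold EY at i2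
    unfold CY at hY
    push_cast at *
    have hmm : (0 : ℤ) ≤ m := by positivity
    have hd : ((m : ℤ) + 2) * (η' (m + 1) - η (m + 1)) ≤
        (m + 1) * (η' (m + 2) - η (m + 2)) := by linarith
    have hpos : η (m + 2) < η' (m + 2) := by
      have : (0 : ℤ) < (m + 1) * (η' (m + 2) - η (m + 2)) :=
        lt_of_lt_of_le (mul_pos (by positivity) (by linarith)) hd
      have := (mul_pos_iff_of_pos_left (by positivity)).mp this
      linarith
    have hinc : η' (m + 1) - η (m + 1) < η' (m + 2) - η (m + 2) := by
      by_contra hcon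
      push Not at hcon
      nlinarith
    have hlt : ((m : ℤ) + 1 + 2) * (η' (m + 1) - η (m + 1)) <
        (m + 1 + 1) * (η' (m + 2) - η (m + 2)) := by
      have h3 : ((m : ℤ) + 1) * ((m + 3) * (η' (m + 1) - η (m + 1))) <
          (m + 1) * ((m + 2) * (η' (m + 2) - η (m + 2))) := by nlinarith
      have := lt_of_mul_lt_mul_left h3 (by positivity)
      linarith
    obtain ⟨k1, k2⟩ := key (m + 1) hpos (by push_cast; exact hlt)
    exact ⟨hpos, k1, k2, hinc, hlt⟩

theorem EX_large (a b : ℕ →₀ ℕ) : ∃ N, ∀ n, N ≤ n →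
    (EX (EE a) (EE b) n ↔ QQ a = QQ b + SS b) ∧ (CX (EE a) (EE b) n ↔ QQ a ≤ QQ b + SS b) ∧
    (EY (EE a) (EE b) n ↔ QQ b = QQ a + SS a) ∧ (CY (EE a) (EE b) n ↔ QQ b ≤ QQ a + SS a) := by
  obtain ⟨N1, h1⟩ := EE_large a
  obtain ⟨N2, h2⟩ := EE_large b
  refine ⟨N1 + N2, fun n hn => ?_⟩
  unfold EX CX EY CY
  rw [h1 n (by omega), h1 (n + 1) (by omega), h1 (n + 2) (by omega), h2 n (by omega),
    h2 (n + 1) (by omega), h2 (n + 2) (by omega)]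
  push_cast
  refine ⟨⟨fun h => ?_, fun h => ?_⟩, ⟨fun h => ?_, fun h => ?_⟩, ⟨fun h => ?_, fun h => ?_⟩,
    ⟨fun h => ?_, fun h => ?_⟩⟩ <;> linarith

theorem Compat.limit {a b : ℕ →₀ ℕ} (h : Compat (EE a) (EE b)) :
    QQ a = QQ b + SS b ∨ QQ b = QQ a + SS a := by
  obtain ⟨N, hN⟩ := EX_large a b
  obtain ⟨h1, _, h3, _⟩ := hN N le_rfl
  exact (h N).2.2.imp h1.mp h3.mp

/-- Comparison of two left sequences compatible with the same right sequence. -/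
theorem compare {a b b' : ℕ →₀ ℕ} (h : Compat (EE a) (EE b)) (h' : Compat (EE a) (EE b'))
    (hne : b ≠ b') :
    (SS b < SS b' ∧ QQ b' = QQ a + SS a ∧ QQ a ≠ QQ b' + SS b') ∨
    (SS b' < SS b ∧ QQ b = QQ a + SS a ∧ QQ a ≠ QQ b + SS b) := by
  have gen : ∀ {b b' : ℕ →₀ ℕ} (_ : Compat (EE a) (EE b)) (_ : Compat (EE a) (EE b')) (n : ℕ)
      (_ : EE b n = EE b' n) (_ : EE b (n + 1) < EE b' (n + 1)),
      SS b < SS b' ∧ QQ b' = QQ a + SS a ∧ QQ a ≠ QQ b' + SS b' := by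
    intro b b' h h' n h0 h1
    obtain ⟨N, hN⟩ := EX_large a b'
    obtain ⟨N1, hN1⟩ := EE_large b
    obtain ⟨N2, hN2⟩ := EE_large b'
    obtain ⟨_, c2, c3, c4, _⟩ := compare_step h h' n h0 h1 (N + N1 + N2)
    generalize hm : n + (N + N1 + N2) = m at *
    obtain ⟨l1, _, l3, _⟩ := hN m (by omega)
    refine ⟨?_, l3.mp c2, fun e => c3 (l1.mpr e)⟩
    rw [hN1 m (by omega), hN1 (m + 1) (by omega), hN2 m (by omega), hN2 (m + 1) (by omega)] at c4
    push_cast at c4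
    linarith
  have hex : ∃ n, EE b n ≠ EE b' n := by
    by_contra hcon
    push Not at hcon
    exact hne (EE_inj hcon)
  classical
  have hs := Nat.find_spec hex
  have hmin := fun m => @Nat.find_min _ _ hex m
  generalize Nat.find hex = n at *
  cases n with
  | zero => exact absurd (by rw [EE_zero, EE_zero]) hs
  | succ n =>
    have h0 : EE b n = EE b' n := by
      by_contra hc
      exact hmin n (by omega) hc
    rcases lt_or_gt_of_ne hs with hlt | hlt
    · exact Or.inl (gen h h' n h0 hlt)
    · exact Or.inr (gen h' h n h0.symm hlt)

theorem min_width {a b b' : ℕ →₀ ℕ} (h : Compat (EE a) (EE b)) (h' : Compat (EE a) (EE b'))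
    (hx : QQ a = QQ b + SS b) : SS b ≤ SS b' := by
  by_cases hne : b = b'
  · rw [hne]
  · rcases compare h h' hne with hc | hc
    · exact hc.1.le
    · exact absurd hx hc.2.2

/-! ### Existence -/

/-- The line-type lower bound. -/
def ell (θ : ℕ → ℤ) (e : ℤ) : ℕ → ℤ
  | 0 => 0
  | n + 1 => θ n + (n + 1) * e

theorem max_local (θ m : ℕ → ℤ) (e : ℤ) (i : ℕ)
    (hprev : ((i : ℤ) + 1) * (ell θ e i - m i) ≤ i * (ell θ e (i + 1) - m (i + 1)))
    (hX : CX θ m i)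
    (hB : ell θ e (i + 1) < m (i + 1) → CY θ m i ∧ (EX θ m i ∨ EY θ m i))
    (hA : m (i + 1) ≤ ell θ e (i + 1) → m (i + 2) ≤ ell θ e (i + 2)) :
    CX θ (fun i => max (m i) (ell θ e i)) i ∧ CY θ (fun i => max (m i) (ell θ e i)) i ∧
      (EX θ (fun i => max (m i) (ell θ e i)) i ∨ EY θ (fun i => max (m i) (ell θ e i)) i) := by
  have e1 : ell θ e (i + 1) = θ i + (i + 1) * e := rfl
  have e2 : ell θ e (i + 2) = θ (i + 1) + ((i : ℤ) + 1 + 1) * e := by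
    show θ (i + 1) + ((i + 1 : ℕ) + 1) * e = _
    push_cast
    ring
  have hi : (0 : ℤ) ≤ i := by positivity
  unfold CX EX CY EY at *
  dsimp only at *
  rcases le_or_gt (m (i + 1)) (ell θ e (i + 1)) with h1 | h1
  · have h2 := hA h1
    rw [max_eq_right h1, max_eq_right h2]
    have hEY : ((i : ℤ) + 2) * (θ i - ell θ e (i + 1)) =
        (i + 1) * (θ (i + 1) - ell θ e (i + 2)) := by
      rw [e1, e2]; ring
    refine ⟨?_, hEY.le, Or.inr hEY⟩
    rcases le_total (m i) (ell θ e i) with h0 | h0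
    · rw [max_eq_right h0]
      by_cases hz : i = 0
      · subst hz
        simp only [CharP.cast_eq_zero, zero_mul, zero_add, one_mul] at *
        have : ell θ e 0 = 0 := rfl
        linarith
      · have hip : (1 : ℤ) ≤ i := by exact_mod_cast Nat.one_le_iff_ne_zero.mpr hz
        have : (i : ℤ) * ((i + 2) * (ell θ e i - m i)) ≤
            i * ((i + 1) * (ell θ e (i + 1) - m (i + 1))) := by nlinarith
        have := le_of_mul_le_mul_left this (by linarith)
        linarith
    · rw [max_eq_left h0]
      nlinarith
  · obtain ⟨hY, hE⟩ := hB h1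
    have h0 : ell θ e i ≤ m i := by
      by_contra hcon
      push Not at hcon
      nlinarith
    rw [max_eq_left h0, max_eq_left h1.le]
    rcases le_or_gt (ell θ e (i + 2)) (m (i + 2)) with h2 | h2
    · rw [max_eq_left h2]
      exact ⟨hX, hY, hE⟩
    · rw [max_eq_right h2.le]
      refine ⟨hX, ?_, Or.inl ?_⟩
      · rw [e2]; rw [e1] at h1; nlinarith
      · refine hE.resolve_right fun hEY => ?_
        rw [e2] at h2
        rw [e1] at h1
        nlinarith

theorem ell_convex (a : ℕ →₀ ℕ) (e : ℤ) (i : ℕ) :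
    0 ≤ ell (EE a) e (i + 2) - 2 * ell (EE a) e (i + 1) + ell (EE a) e i := by
  cases i with
  | zero =>
    show 0 ≤ (EE a 1 + ((1 : ℕ) + 1) * e) - 2 * (EE a 0 + ((0 : ℕ) + 1) * e) + 0
    rw [EE_zero, EE_one]
    push_cast
    have : (0 : ℤ) ≤ a 0 := by positivity
    linarith
  | succ i =>
    show 0 ≤ (EE a (i + 2) + ((i + 2 : ℕ) + 1) * e) - 2 * (EE a (i + 1) + ((i + 1 : ℕ) + 1) * e)
      + (EE a i + (i + 1) * e)
    rw [EE_succ_succ]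
    push_cast
    have : (0 : ℤ) ≤ a (i + 1) := by positivity
    linarith

theorem max_convex (x y : ℕ → ℤ) (i : ℕ) (hx : 0 ≤ x (i + 2) - 2 * x (i + 1) + x i)
    (hy : 0 ≤ y (i + 2) - 2 * y (i + 1) + y i) :
    0 ≤ max (x (i + 2)) (y (i + 2)) - 2 * max (x (i + 1)) (y (i + 1)) + max (x i) (y i) := by
  have a1 := le_max_left (x (i + 2)) (y (i + 2))
  have a2 := le_max_right (x (i + 2)) (y (i + 2))
  have a3 := le_max_left (x i) (y i)
  have a4 := le_max_right (x i) (y i)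
  rcases le_total (x (i + 1)) (y (i + 1)) with h | h
  · rw [max_eq_right h]; linarith
  · rw [max_eq_left h]; linarith

/-- Consequence of `CY` on the difference with `ell`. -/
theorem CY_mono (θ m : ℕ → ℤ) (e : ℤ) (i : ℕ) (h : CY θ m i) :
    ((i : ℤ) + 2) * (ell θ e (i + 1) - m (i + 1)) ≤
      (i + 1) * (ell θ e (i + 2) - m (i + 2)) := by
  have e1 : ell θ e (i + 1) = θ i + (i + 1) * e := rfl
  have e2 : ell θ e (i + 2) = θ (i + 1) + ((i : ℤ) + 1 + 1) * e := by
    show θ (i + 1) + ((i + 1 : ℕ) + 1) * e = _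
    push_cast
    ring
  unfold CY at h
  rw [e1, e2]
  linarith

/-- `hprev` for `max_local`. -/
theorem prev_of_CY (θ m : ℕ → ℤ) (e : ℤ) (i : ℕ) (h0 : m 0 = 0)
    (h : ∀ j, j + 1 = i → CY θ m j) :
    ((i : ℤ) + 1) * (ell θ e i - m i) ≤ i * (ell θ e (i + 1) - m (i + 1)) := by
  cases i with
  | zero => simp [h0, ell]
  | succ j =>
    have := CY_mono θ m e j (h j rfl)
    push_cast
    linarith

/-- Partial minimal solution. -/
structure PartSol (a : ℕ →₀ ℕ) (p : ℕ) (m : ℕ → ℤ) : Prop where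
  zero : m 0 = 0
  one : 0 ≤ m 1
  conv : ∀ i, i < p → 0 ≤ m (i + 2) - 2 * m (i + 1) + m i
  cond : ∀ i, i < p → CX (EE a) m i ∧ CY (EE a) m i ∧ (EX (EE a) m i ∨ EY (EE a) m i)
  eqx : EX (EE a) m p
  yw : (p : ℤ) * m (p + 1) - (p + 1) * m p ≤ (p + 1) * EE a (p + 1) - (p + 2) * EE a p

theorem part_zero (a : ℕ →₀ ℕ) : PartSol a 0 (fun i => if i = 0 then 0 else (a 1 : ℤ)) := by
  refine ⟨by simp, by simp, fun i hi => absurd hi (by omega), fun i hi => absurd hi (by omega),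
    ?_, ?_⟩
  · unfold EX
    rw [EE_succ_succ]
    simp [EE_one, EE_zero]
  · simp [EE_one, EE_zero]

/-- `CY` at `i` gives the weak `Y` inequality at `i+1`. -/
theorem yw_of_CY (a : ℕ →₀ ℕ) (m : ℕ → ℤ) (i : ℕ) (h : CY (EE a) m i) :
    ((i : ℤ) + 1) * m (i + 2) - (i + 2) * m (i + 1) ≤
      (i + 2) * EE a (i + 2) - (i + 3) * EE a (i + 1) := by
  have h2 := EE_succ_succ a i
  have : (0 : ℤ) ≤ (i + 2) * a (i + 1) := by positivity
  unfold CY at h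
  rw [h2]
  linarith

theorem part_succ (a : ℕ →₀ ℕ) (p : ℕ) (m : ℕ → ℤ) (hm : PartSol a p m) :
    ∃ m', PartSol a (p + 1) m' := by
  obtain ⟨m0, m1, mconv, mcond, mx, my⟩ := hm
  -- extended sequence
  obtain ⟨M, hM, hM2⟩ : ∃ M : ℕ → ℤ, (∀ i, i ≤ p + 1 → M i = m i) ∧
      M (p + 2) = 2 * m (p + 1) - m p + a (p + 2) :=
    ⟨fun i => if i = p + 2 then 2 * m (p + 1) - m p + a (p + 2) else m i,
      fun i hi => if_neg (by omega), if_pos rfl⟩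
  have hpp : (0 : ℤ) ≤ p := by positivity
  have Mconv : ∀ i, i < p + 1 → 0 ≤ M (i + 2) - 2 * M (i + 1) + M i := by
    intro i hi
    rcases Nat.lt_succ_iff_lt_or_eq.mp hi with h | h
    · rw [hM _ (by omega), hM _ (by omega), hM _ (by omega)]
      exact mconv i h
    · subst h
      rw [hM2, hM _ (by omega), hM _ (by omega)]
      have : (0 : ℤ) ≤ a (i + 2) := by positivity
      linarith
  have Mcond : ∀ i, i < p → CX (EE a) M i ∧ CY (EE a) M i ∧ (EX (EE a) M i ∨ EY (EE a) M i) := by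
    intro i hi
    have := mcond i hi
    unfold CX CY EX EY at *
    rw [hM _ (by omega), hM _ (by omega), hM _ (by omega)]
    exact this
  have MEp : EX (EE a) M p := by
    unfold EX at *
    rw [hM _ (by omega), hM _ (by omega)]
    exact mx
  have hθ := EE_succ_succ a p
  have hθ' := EE_succ_succ a (p + 1)
  have MEp1 : EX (EE a) M (p + 1) := by
    unfold EX at *
    rw [hM _ (by omega)]
    show _ = _ * (M (p + 2) - EE a (p + 3))
    rw [hM2, hθ', hθ]
    rw [hθ] at mx
    push_cast
    linarith
  obtain ⟨e, he⟩ : ∃ e : ℤ, e = (p + 3) * (EE a p - EE a (p + 2))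
      - (p + 2) * (EE a (p + 1) - EE a (p + 3)) := ⟨_, rfl⟩
  have l1 : ell (EE a) e (p + 1) = EE a p + (p + 1) * e := rfl
  have l2 : ell (EE a) e (p + 2) = EE a (p + 1) + ((p : ℤ) + 1 + 1) * e := by
    show EE a (p + 1) + ((p + 1 : ℕ) + 1) * e = _
    push_cast
    ring
  have hlX : ((p : ℤ) + 3) * (ell (EE a) e (p + 1) - EE a (p + 2)) =
      (p + 2) * (ell (EE a) e (p + 2) - EE a (p + 3)) := by
    rw [l1, l2]
    linarith
  have hd : ((p : ℤ) + 3) * (ell (EE a) e (p + 1) - M (p + 1)) =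
      (p + 2) * (ell (EE a) e (p + 2) - M (p + 2)) := by
    unfold EX at MEp1
    push_cast at MEp1
    have e3 : p + 1 + 1 = p + 2 := rfl
    have e4 : p + 1 + 2 = p + 3 := rfl
    rw [e3, e4] at MEp1
    linarith
  -- once nonnegative, always nonnegative
  have hA : ∀ i, i < p + 1 → M (i + 1) ≤ ell (EE a) e (i + 1) →
      M (i + 2) ≤ ell (EE a) e (i + 2) := by
    intro i hi h
    rcases Nat.lt_succ_iff_lt_or_eq.mp hi with h' | h'
    · have := CY_mono _ M e i (Mcond i h').2.1
      have hi0 : (0 : ℤ) ≤ i := by positivity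
      by_contra hcon
      push Not at hcon
      nlinarith
    · subst h'
      by_contra hcon
      push Not at hcon
      nlinarith
  have M0 : M 0 = 0 := by rw [hM _ (by omega), m0]
  -- CY at p when below
  have hCYp : ell (EE a) e (p + 1) < M (p + 1) → CY (EE a) M p := by
    intro h
    unfold CY
    have h5 : ((p : ℤ) + 2) * (ell (EE a) e (p + 1) - M (p + 1)) ≤
        (p + 1) * (ell (EE a) e (p + 2) - M (p + 2)) := by
      have : ((p : ℤ) + 2) * ((p + 2) * (ell (EE a) e (p + 1) - M (p + 1))) ≤
        (p + 2) * ((p + 1) * (ell (EE a) e (p + 2) - M (p + 2))) := by nlinarith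
      exact le_of_mul_le_mul_left this (by linarith)
    rw [l1, l2] at h5
    linarith
  have main : ∀ i, i < p + 1 → _ := fun i hi => max_local (EE a) M e i
    (prev_of_CY _ M e i M0 fun j hj => (Mcond j (by omega)).2.1)
    (by
      rcases Nat.lt_succ_iff_lt_or_eq.mp hi with h' | h'
      · exact (Mcond i h').1
      · subst h'; exact le_of_eq MEp)
    (by
      intro h
      rcases Nat.lt_succ_iff_lt_or_eq.mp hi with h' | h'
      · exact (Mcond i h').2
      · subst h'; exact ⟨hCYp h, Or.inl MEp⟩)
    (hA i hi)
  refine ⟨fun i => max (M i) (ell (EE a) e i), ?_, ?_, ?_, main, ?_, ?_⟩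
  · simp [M0, ell]
  · exact le_max_of_le_left (by rw [hM _ (by omega)]; exact m1)
  · intro i hi
    exact max_convex M _ i (Mconv i hi) (ell_convex a e i)
  · unfold EX at *
    push_cast at *
    have e3 : p + 1 + 1 = p + 2 := rfl
    have e4 : p + 1 + 2 = p + 3 := rfl
    rw [e3, e4] at *
    rcases le_or_gt (M (p + 1)) (ell (EE a) e (p + 1)) with h | h
    · rw [max_eq_right h, max_eq_right (hA p (by omega) h)]
      linarith
    · have h2 : ell (EE a) e (p + 2) < M (p + 2) := by
        by_contra hcon
        push Not at hcon
        nlinarith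
      rw [max_eq_left h.le, max_eq_left h2.le]
      linarith
  · have := yw_of_CY a _ p (main p (by omega)).2.1
    push_cast
    have e3 : p + 1 + 1 = p + 2 := rfl
    rw [e3]
    linarith

theorem part_exists (a : ℕ →₀ ℕ) (p : ℕ) : ∃ m, PartSol a p m := by
  induction p with
  | zero => exact ⟨_, part_zero a⟩
  | succ p ih =>
    obtain ⟨m, hm⟩ := ih
    exact part_succ a p m hm

/-- The minimal compatible sequence. -/
theorem min_exists (a : ℕ →₀ ℕ) :
    ∃ b : ℕ →₀ ℕ, Compat (EE a) (EE b) ∧ QQ a = QQ b + SS b := by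
  obtain ⟨p, hp⟩ := support_bound a
  obtain ⟨m, hm⟩ := part_exists a p
  obtain ⟨m0, m1, mconv, mcond, mx, my⟩ := hm
  obtain ⟨M, hM, hM2⟩ : ∃ M : ℕ → ℤ, (∀ i, i ≤ p + 1 → M i = m i) ∧
      (∀ i, p ≤ i → M i = m p + (i - p) * (m (p + 1) - m p)) := by
    refine ⟨fun i => if i ≤ p + 1 then m i else m p + (i - p) * (m (p + 1) - m p),
      fun i hi => if_pos hi, fun i hi => ?_⟩
    dsimp only
    split_ifs with h
    · obtain rfl | rfl : i = p ∨ i = p + 1 := by omega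
      · ring
      · push_cast; ring
    · rfl
  have Mlin : ∀ i, p ≤ i → M (i + 2) = 2 * M (i + 1) - M i := by
    intro i hi
    rw [hM2 i hi, hM2 (i + 1) (by omega), hM2 (i + 2) (by omega)]
    push_cast
    ring
  have tail : ∀ k, EX (EE a) M (p + k) ∧ CY (EE a) M (p + k) := by
    intro k
    induction k with
    | zero =>
      constructor
      · unfold EX at *
        rw [add_zero, hM _ (by omega), hM _ (by omega)]
        exact mx
      · unfold CY
        rw [add_zero, Mlin p le_rfl, hM _ (by omega), hM _ (by omega)]
        linarith
    | succ k ih =>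
      generalize hq : p + k = q at *
      have e1 : p + (k + 1) = q + 1 := by omega
      rw [e1]
      obtain ⟨ih1, ih2⟩ := ih
      have hθ := EE_succ_succ a q
      have hθ' := EE_succ_succ a (q + 1)
      rw [hp (q + 1) (by omega)] at hθ
      rw [hp (q + 1 + 1) (by omega)] at hθ'
      have hl := Mlin q (by omega)
      have hl' := Mlin (q + 1) (by omega)
      constructor
      · unfold EX at *
        push_cast at *
        have e3 : q + 1 + 1 = q + 2 := rfl
        have e4 : q + 1 + 2 = q + 3 := rfl
        rw [e3, e4] at *
        rw [hθ', hl, hθ]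
        rw [hθ] at ih1
        linarith
      · unfold CY at *
        push_cast at *
        have e3 : q + 1 + 1 = q + 2 := rfl
        have e4 : q + 1 + 2 = q + 3 := rfl
        rw [e3, e4] at *
        rw [hl', hθ, hl]
        rw [hl] at ih2
        linarith
  have hcomp : Compat (EE a) M := by
    intro n
    by_cases h : n < p
    · have := mcond n h
      unfold CX CY EX EY at *
      rw [hM _ (by omega), hM _ (by omega), hM _ (by omega)]
      exact this
    · obtain ⟨k, rfl⟩ := Nat.exists_eq_add_of_le (not_lt.mp h)
      obtain ⟨t1, t2⟩ := tail k
      exact ⟨le_of_eq t1, t2, Or.inl t1⟩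
  obtain ⟨b, hb, -, -⟩ := EE_of_convex M (by rw [hM _ (by omega), m0])
    (by rw [hM _ (by omega)]; exact m1)
    (by
      intro i
      by_cases h : i < p
      · rw [hM _ (by omega), hM _ (by omega), hM _ (by omega)]
        exact mconv i h
      · rw [Mlin i (by omega)]
        linarith)
    (m (p + 1) - m p) (p * (m (p + 1) - m p) - m p) p
    (by
      intro n hn
      rw [hM2 n hn]
      ring)
  obtain rfl : EE b = M := funext hb
  refine ⟨b, hcomp, ?_⟩
  obtain ⟨N, hN⟩ := EX_large a b
  exact (hN (p + N) (by omega)).1.mp (tail N).1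

/-- Compatible sequences of larger width. -/
theorem larger_exists (a b : ℕ →₀ ℕ) (h : Compat (EE a) (EE b)) (T : ℤ) (hT : SS b < T) :
    ∃ b' : ℕ →₀ ℕ, Compat (EE a) (EE b') ∧ SS b' = T ∧ QQ b' = QQ a + SS a := by
  obtain ⟨e, he⟩ : ∃ e, e = T - SS a := ⟨_, rfl⟩
  have hA : ∀ i, EE b (i + 1) ≤ ell (EE a) e (i + 1) →
      EE b (i + 2) ≤ ell (EE a) e (i + 2) := by
    intro i h'
    have := CY_mono _ (EE b) e i (h i).2.1
    have hi0 : (0 : ℤ) ≤ i := by positivity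
    by_contra hcon
    push Not at hcon
    nlinarith
  have hcomp : Compat (EE a) (fun i => max (EE b i) (ell (EE a) e i)) := fun i =>
    max_local (EE a) (EE b) e i (prev_of_CY _ _ e i (EE_zero b) fun j _ => (h j).2.1)
      (h i).1 (fun _ => (h i).2) (hA i)
  obtain ⟨N1, h1⟩ := EE_large a
  obtain ⟨N2, h2⟩ := EE_large b
  obtain ⟨b', hb', hS, hQ⟩ := EE_of_convex (fun i => max (EE b i) (ell (EE a) e i))
    (by simp [EE_zero, ell])
    (le_max_of_le_left (by rw [EE_one]; positivity))
    (fun i => max_convex (EE b) _ i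
      (by
        rw [EE_succ_succ]
        have : (0 : ℤ) ≤ b (i + 1) := by positivity
        linarith) (ell_convex a e i))
    T (QQ a + SS a) (N1 + N2 + 1 + (QQ a + SS a).toNat)
    (by
      intro n hn
      obtain ⟨k, rfl⟩ : ∃ k, n = k + 1 := ⟨n - 1, by omega⟩
      have l1 : ell (EE a) e (k + 1) = EE a k + (k + 1) * e := rfl
      have hn' : QQ a + SS a ≤ ((k + 1 : ℕ) : ℤ) := by
        have := Int.self_le_toNat (QQ a + SS a)
        omega
      have hq := QQ_nonneg b
      rw [l1, h1 k (by omega), h2 (k + 1) (by omega), he, max_eq_right]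
      · push_cast; ring
      · push_cast at *
        nlinarith)
  obtain e1 : EE b' = _ := funext hb'
  refine ⟨b', ?_, hS, hQ⟩
  rw [e1]
  exact hcomp
/-! ### Translation of the polytope conditions -/

def low (root : LatL) (a : ℕ →₀ ℕ) (k : ℕ) : LatL :=
  ∑ j ∈ Finset.range k, (a j) • (root + j • deltaL)

theorem low_alpha1 (a : ℕ →₀ ℕ) (n : ℕ) : low alpha1 a (n + 1) =
    (n * EE a (n + 1) - (n + 1) * EE a n, (n + 1) * EE a (n + 1) - (n + 2) * EE a n) := by
  induction n with
  | zero => simp [low, EE_zero, EE_one, alpha1]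
  | succ n ih =>
    unfold low at *
    rw [Finset.sum_range_succ, ih, EE_succ_succ]
    ext
    · simp [alpha1, deltaL]; ring
    · simp [alpha1, deltaL]; ring

theorem low_alpha0 (a : ℕ →₀ ℕ) (n : ℕ) : low alpha0 a (n + 1) =
    ((n + 1) * EE a (n + 1) - (n + 2) * EE a n, n * EE a (n + 1) - (n + 1) * EE a n) := by
  induction n with
  | zero => simp [low, EE_zero, EE_one, alpha0]
  | succ n ih =>
    unfold low at *
    rw [Finset.sum_range_succ, ih, EE_succ_succ]
    ext
    · simp [alpha0, deltaL]; ring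
    · simp [alpha0, deltaL]; ring

theorem sum_fst_snd (a : ℕ →₀ ℕ) (root : LatL) :
    (a.sum fun j m => m • (root + j • deltaL)) =
      (root.1 * SS a + QQ a, root.2 * SS a + QQ a) := by
  unfold SS QQ Finsupp.sum
  rw [Finset.mul_sum, Finset.mul_sum, ← Finset.sum_add_distrib, ← Finset.sum_add_distrib]
  ext
  · rw [Prod.fst_sum]
    apply Finset.sum_congr rfl
    intro i _
    simp [deltaL]; ring
  · rw [Prod.snd_sum]
    apply Finset.sum_congr rfl
    intro i _
    simp [deltaL]; ring

theorem muInf_eq (d : LusztigDatum) (root : LatL) :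
    d.muInf root = (root.1 * SS d.a + QQ d.a, root.2 * SS d.a + QQ d.a) :=
  sum_fst_snd d.a root

theorem muTopInf_eq (d : LusztigDatum) (root : LatL) :
    d.muTopInf root = (root.1 * SS d.a + QQ d.a + d.lam.sum,
      root.2 * SS d.a + QQ d.a + d.lam.sum) := by
  unfold LusztigDatum.muTopInf
  rw [muInf_eq]
  ext <;> simp [deltaL]

theorem muHigh_zero (d : LusztigDatum) (s o : LatL) :
    d.muHigh s o 0 = (s.1 * SS d.a + QQ d.a + d.lam.sum + (o.1 * SS d.A + QQ d.A),
      s.2 * SS d.a + QQ d.a + d.lam.sum + (o.2 * SS d.A + QQ d.A)) := by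
  have := sum_fst_snd d.A o
  unfold Finsupp.sum at this
  unfold LusztigDatum.muHigh
  rw [muTopInf_eq, Finset.filter_true_of_mem (fun _ _ => Nat.zero_le _), this]
  rfl

theorem muHigh_eq (d : LusztigDatum) (s o : LatL) (k : ℕ) :
    d.muHigh s o k = d.muHigh s o 0 - low o d.A k := by
  unfold LusztigDatum.muHigh
  rw [Finset.filter_true_of_mem (s := d.A.support) (p := fun j => 0 ≤ j)
    (fun _ _ => Nat.zero_le _), ← Finset.sum_filter_add_sum_filter_not d.A.support (fun j => k ≤ j)]
  have : ∑ j ∈ d.A.support.filter (fun j => ¬ k ≤ j), (d.A j) • (o + j • deltaL) =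
      low o d.A k := by
    unfold low
    apply Finset.sum_subset
    · intro j hj
      rw [Finset.mem_filter] at hj
      rw [Finset.mem_range]
      omega
    · intro j hj hj'
      rw [Finset.mem_range] at hj
      rw [Finset.mem_filter, Finsupp.mem_support_iff] at hj'
      have : d.A j = 0 := by
        by_contra hc
        exact hj' ⟨hc, by omega⟩
      rw [this, zero_smul]
  rw [this]
  abel

/-- Convenient form of the polytope conditions. -/
structure IsMV (R L : LusztigDatum) : Prop where
  cl1 : QQ R.a + R.lam.sum + QQ R.A + SS R.A = QQ L.a + SS L.a + L.lam.sum + QQ L.A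
  cl2 : QQ L.a + L.lam.sum + QQ L.A + SS L.A = QQ R.a + SS R.a + R.lam.sum + QQ R.A
  lo : Compat (EE R.a) (EE L.a)
  hi : Compat (EE R.A) (EE L.A)
  parts : R.lam = L.lam ∨ ∃ n : ℕ, (n : ℤ) = SS R.a + SS L.a ∧
    (R.lam = n ::ₘ L.lam ∨ L.lam = n ::ₘ R.lam)
  sizeR : ∀ x ∈ R.lam, (x : ℤ) ≤ SS R.a + SS L.a
  sizeL : ∀ x ∈ L.lam, (x : ℤ) ≤ SS R.a + SS L.a

theorem IsMV.symm {R L : LusztigDatum} (h : IsMV R L) : IsMV L R where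
  cl1 := h.cl2
  cl2 := h.cl1
  lo := h.lo.symm
  hi := h.hi.symm
  parts := by
    rcases h.parts with h | ⟨n, hn, h⟩
    · exact Or.inl h.symm
    · exact Or.inr ⟨n, by rw [hn, add_comm], h.symm⟩
  sizeR := by rw [add_comm]; exact h.sizeL
  sizeL := by rw [add_comm]; exact h.sizeR

theorem closing_iff (R L : LusztigDatum) :
    R.muHigh alpha1 alpha0 0 = L.muHigh alpha0 alpha1 0 ↔
    (QQ R.a + R.lam.sum + QQ R.A + SS R.A = QQ L.a + SS L.a + L.lam.sum + QQ L.A ∧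
     QQ L.a + L.lam.sum + QQ L.A + SS L.A = QQ R.a + SS R.a + R.lam.sum + QQ R.A) := by
  rw [muHigh_zero, muHigh_zero, Prod.mk.injEq]
  simp only [alpha0, alpha1]
  constructor
  · rintro ⟨h1, h2⟩
    constructor <;> linarith
  · rintro ⟨h1, h2⟩
    constructor <;> linarith

theorem low_iff (a b : ℕ →₀ ℕ) :
    (∀ k : ℕ, 2 ≤ k → (low alpha0 b k - low alpha1 a (k - 1)).2 ≤ 0 ∧
      (low alpha1 a k - low alpha0 b (k - 1)).1 ≤ 0 ∧
      ((low alpha0 b k - low alpha1 a (k - 1)).2 = 0 ∨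
        (low alpha1 a k - low alpha0 b (k - 1)).1 = 0)) ↔ Compat (EE a) (EE b) := by
  have key : ∀ n : ℕ, ((low alpha0 b (n + 2) - low alpha1 a (n + 1)).2 =
      ((n : ℤ) + 2) * (EE a n - EE b (n + 1)) - (n + 1) * (EE a (n + 1) - EE b (n + 2))) ∧
      ((low alpha1 a (n + 2) - low alpha0 b (n + 1)).1 =
      ((n : ℤ) + 2) * (EE b n - EE a (n + 1)) - (n + 1) * (EE b (n + 1) - EE a (n + 2))) := by
    intro n
    rw [low_alpha0 b (n + 1), low_alpha1 a (n + 1), low_alpha0, low_alpha1]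
    simp only [Prod.snd_sub, Prod.fst_sub]
    push_cast
    have e : n + 1 + 1 = n + 2 := rfl
    rw [e]
    constructor <;> ring
  constructor
  · intro h n
    have := h (n + 2) (by omega)
    rw [show n + 2 - 1 = n + 1 from rfl, (key n).1, (key n).2] at this
    unfold CX CY EX EY
    obtain ⟨h1, h2, h3⟩ := this
    exact ⟨by linarith, by linarith, h3.symm.imp (fun h => by linarith) (fun h => by linarith)⟩
  · intro h k hk
    obtain ⟨n, rfl⟩ : ∃ n, k = n + 2 := ⟨k - 2, by omega⟩
    rw [show n + 2 - 1 = n + 1 from rfl, (key n).1, (key n).2]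
    obtain ⟨h1, h2, h3⟩ := h n
    unfold CX CY EX EY at *
    exact ⟨by linarith, by linarith, h3.symm.imp (fun h => by linarith) (fun h => by linarith)⟩

theorem high_iff (R L : LusztigDatum)
    (hc : R.muHigh alpha1 alpha0 0 = L.muHigh alpha0 alpha1 0) :
    (∀ k : ℕ, 2 ≤ k →
    0 ≤ (L.muHigh alpha0 alpha1 k - R.muHigh alpha1 alpha0 (k - 1)).1 ∧
    0 ≤ (R.muHigh alpha1 alpha0 k - L.muHigh alpha0 alpha1 (k - 1)).2 ∧
    ((L.muHigh alpha0 alpha1 k - R.muHigh alpha1 alpha0 (k - 1)).1 = 0 ∨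
      (R.muHigh alpha1 alpha0 k - L.muHigh alpha0 alpha1 (k - 1)).2 = 0)) ↔
    Compat (EE R.A) (EE L.A) := by
  have e1 : ∀ k, (L.muHigh alpha0 alpha1 k - R.muHigh alpha1 alpha0 (k - 1)).1 =
      - (low alpha1 L.A k - low alpha0 R.A (k - 1)).1 := by
    intro k
    rw [muHigh_eq L, muHigh_eq R, hc]
    simp only [Prod.fst_sub]
    ring
  have e2 : ∀ k, (R.muHigh alpha1 alpha0 k - L.muHigh alpha0 alpha1 (k - 1)).2 =
      - (low alpha0 R.A k - low alpha1 L.A (k - 1)).2 := by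
    intro k
    rw [muHigh_eq L, muHigh_eq R, hc]
    simp only [Prod.snd_sub]
    ring
  have e3 : Compat (EE R.A) (EE L.A) ↔ Compat (EE L.A) (EE R.A) :=
    ⟨Compat.symm, Compat.symm⟩
  rw [e3, ← low_iff]
  simp only [e1, e2, neg_eq_zero, Left.nonneg_neg_iff]
  refine forall_congr' fun k => forall_congr' fun _ => ?_
  tauto

theorem width_eq (R L : LusztigDatum) :
    (R.muInf alpha1 - L.muInf alpha0).2 - (R.muInf alpha1 - L.muInf alpha0).1 =
      SS R.a + SS L.a := by
  rw [muInf_eq, muInf_eq]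
  simp only [alpha0, alpha1, Prod.snd_sub, Prod.fst_sub]
  ring

theorem parts_iff (R L : LusztigDatum) :
    (if (R.muInf alpha1 - L.muInf alpha0).1 * (R.muTopInf alpha1 - L.muTopInf alpha0).2
        = (R.muInf alpha1 - L.muInf alpha0).2 * (R.muTopInf alpha1 - L.muTopInf alpha0).1
     then R.lam = L.lam
     else ∃ n : ℕ,
        (n : ℤ) = (R.muInf alpha1 - L.muInf alpha0).2 - (R.muInf alpha1 - L.muInf alpha0).1 ∧
        (R.lam = n ::ₘ L.lam ∨ L.lam = n ::ₘ R.lam)) ↔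
    (R.lam = L.lam ∨ ∃ n : ℕ, (n : ℤ) = SS R.a + SS L.a ∧
      (R.lam = n ::ₘ L.lam ∨ L.lam = n ::ₘ R.lam)) := by
  have key : ((R.muInf alpha1 - L.muInf alpha0).1 * (R.muTopInf alpha1 - L.muTopInf alpha0).2
        = (R.muInf alpha1 - L.muInf alpha0).2 * (R.muTopInf alpha1 - L.muTopInf alpha0).1) ↔
      (SS R.a + SS L.a) * ((R.lam.sum : ℤ) - L.lam.sum) = 0 := by
    rw [muInf_eq, muInf_eq, muTopInf_eq, muTopInf_eq]
    simp only [alpha0, alpha1, Prod.snd_sub, Prod.fst_sub]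
    constructor
    · intro h; linarith
    · intro h; linarith
  rw [width_eq]
  simp only [key]
  split_ifs with h
  · constructor
    · exact Or.inl
    · rintro (h' | ⟨n, hn, h'⟩)
      · exact h'
      · exfalso
        have hpos : 0 < n := by
          rcases h' with h' | h'
          · exact R.lam_pos n (by rw [h']; simp)
          · exact L.lam_pos n (by rw [h']; simp)
        have hn0 : (n : ℤ) ≠ 0 := by exact_mod_cast hpos.ne'
        rw [← hn] at h
        rcases h' with h' | h'
        · rw [h', Multiset.sum_cons] at h
          push_cast at h
          have := (mul_eq_zero.mp h).resolve_left hn0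
          apply hn0; linarith
        · rw [h', Multiset.sum_cons] at h
          push_cast at h
          have := (mul_eq_zero.mp h).resolve_left hn0
          apply hn0; linarith
  · constructor
    · exact Or.inr
    · rintro (h' | h')
      · exact absurd (by rw [h']; ring) h
      · exact h'

theorem MVPolytope.isMV (P : MVPolytope) : IsMV P.R P.L where
  cl1 := ((closing_iff P.R P.L).mp P.closing).1
  cl2 := ((closing_iff P.R P.L).mp P.closing).2
  lo := (low_iff P.R.a P.L.a).mp P.cond_low
  hi := (high_iff P.R P.L P.closing).mp P.cond_high
  parts := (parts_iff P.R P.L).mp P.cond_parts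
  sizeR := by
    intro x hx
    rw [← width_eq]
    exact P.cond_size x (Or.inl hx)
  sizeL := by
    intro x hx
    rw [← width_eq]
    exact P.cond_size x (Or.inr hx)

theorem IsMV.toPoly {R L : LusztigDatum} (h : IsMV R L) :
    ∃ P : MVPolytope, P.R = R ∧ P.L = L :=
  ⟨{ R := R
     L := L
     closing := (closing_iff R L).mpr ⟨h.cl1, h.cl2⟩
     cond_low := (low_iff R.a L.a).mpr h.lo
     cond_high := (high_iff R L ((closing_iff R L).mpr ⟨h.cl1, h.cl2⟩)).mpr h.hi
     cond_parts := (parts_iff R L).mpr h.parts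
     cond_size := by
       intro x hx
       rw [width_eq]
       exact hx.elim (h.sizeR x) (h.sizeL x) }, rfl, rfl⟩

/-! ### The main steps -/

theorem SS_single (p : ℕ) : SS (Finsupp.single 0 p) = p := by
  simp [SS, Finsupp.sum_single_index]

theorem QQ_single (p : ℕ) : QQ (Finsupp.single 0 p) = 0 := by
  simp [QQ, Finsupp.sum_single_index]

theorem SS_zero : SS 0 = 0 := by simp [SS]

theorem QQ_zero : QQ 0 = 0 := by simp [QQ]

theorem EE_zero' (n : ℕ) : EE 0 n = 0 := by simp [EE]

theorem EE_single (p n : ℕ) : EE (Finsupp.single 0 p) n = n * p := by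
  cases n with
  | zero => simp [EE_zero]
  | succ n =>
    unfold EE
    rw [Finset.sum_eq_single 0]
    · simp
    · intro i _ hi
      rw [Finsupp.single_eq_of_ne hi]
      simp
    · simp

theorem compat_single (p : ℕ) : Compat (EE 0) (EE (Finsupp.single 0 p)) := by
  intro n
  unfold CX CY EX EY
  simp only [EE_zero', EE_single]
  push_cast
  have hp : (0 : ℤ) ≤ p := by positivity
  exact ⟨by linarith, by linarith, Or.inr (by ring)⟩

theorem eq_zero_of_SS {a : ℕ →₀ ℕ} (h : SS a = 0) : a = 0 := by
  unfold SS Finsupp.sum at h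
  rw [Finset.sum_eq_zero_iff_of_nonneg (fun _ _ => by positivity)] at h
  ext i
  by_contra hc
  have : ((a i : ℕ) : ℤ) = 0 := h i (Finsupp.mem_support_iff.mpr hc)
  exact hc (by exact_mod_cast this)

theorem step_down {R L : LusztigDatum} (h : IsMV R L) (p : ℕ) (hR : R.a = Finsupp.single 0 p)
    (hL : L.a = 0) :
    ∃ (R' L' : LusztigDatum) (w : ℕ), w ≤ p ∧ IsMV R' L' ∧ R'.a = 0 ∧ R'.lam = R.lam ∧
      R'.A = R.A ∧ L'.a = Finsupp.single 0 w := by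
  have c1 := h.cl1
  have c2 := h.cl2
  have sz := h.sizeR
  rw [hR, hL, SS_zero, QQ_single, QQ_zero] at c1
  rw [hR, hL, SS_single, QQ_single, QQ_zero] at c2
  rw [hR, hL, SS_single, SS_zero, add_zero] at sz
  obtain ⟨b, hb, hbx⟩ := min_exists R.A
  have hmin := min_width hb h.hi hbx
  have hpw : (p : ℤ) = SS R.A + SS L.A := by linarith
  obtain ⟨w0, hw0⟩ : ∃ w0 : ℕ, (w0 : ℤ) = SS R.A + SS b :=
    ⟨(SS R.A + SS b).toNat, Int.toNat_of_nonneg (add_nonneg (SS_nonneg _) (SS_nonneg _))⟩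
  have hw0p : w0 ≤ p := by
    have : (w0 : ℤ) ≤ p := by linarith
    exact_mod_cast this
  by_cases hcase : ∀ x ∈ R.lam, x ≤ w0
  · refine ⟨⟨0, R.lam, R.A, R.lam_pos⟩, ⟨Finsupp.single 0 w0, R.lam, b, R.lam_pos⟩, w0, hw0p,
      ?_, rfl, rfl, rfl, rfl⟩
    refine ⟨?_, ?_, compat_single w0, hb, Or.inl rfl, ?_, ?_⟩ <;>
      simp only [SS_zero, QQ_zero, SS_single, QQ_single, zero_add]
    · linarith
    · linarith
    · intro x hx; exact_mod_cast hcase x hx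
    · intro x hx; exact_mod_cast hcase x hx
  · push Not at hcase
    obtain ⟨x0, hx0, hx0w⟩ := hcase
    obtain ⟨w, hwm, hwmax⟩ : ∃ w ∈ R.lam, ∀ x ∈ R.lam, x ≤ w := by
      obtain ⟨w, hw, hwm⟩ := R.lam.toFinset.exists_max_image id
        ⟨x0, Multiset.mem_toFinset.mpr hx0⟩
      exact ⟨w, Multiset.mem_toFinset.mp hw,
        fun x hx => hwm x (Multiset.mem_toFinset.mpr hx)⟩
    have hww : w0 < w := lt_of_lt_of_le hx0w (hwmax x0 hx0)
    have hww' : (w0 : ℤ) < w := by exact_mod_cast hww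
    obtain ⟨b', hb', hS, hQ⟩ := larger_exists R.A b hb (w - SS R.A) (by linarith)
    have hcons : R.lam = w ::ₘ R.lam.erase w := (Multiset.cons_erase hwm).symm
    have hsum : (R.lam.sum : ℤ) = w + (R.lam.erase w).sum := by
      conv_lhs => rw [hcons, Multiset.sum_cons]
      push_cast
      rfl
    refine ⟨⟨0, R.lam, R.A, R.lam_pos⟩, ⟨Finsupp.single 0 w, R.lam.erase w, b',
      fun x hx => R.lam_pos x (Multiset.mem_of_mem_erase hx)⟩, w, ?_,
      ?_, rfl, rfl, rfl, rfl⟩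
    · exact_mod_cast sz w hwm
    refine ⟨?_, ?_, compat_single w, hb', Or.inr ⟨w, ?_, Or.inl hcons⟩, ?_, ?_⟩ <;>
      simp only [SS_zero, QQ_zero, SS_single, QQ_single, zero_add]
    · linarith
    · linarith
    · intro x hx; exact_mod_cast hwmax x hx
    · intro x hx; exact_mod_cast hwmax x (Multiset.mem_of_mem_erase hx)

theorem step_up {R L R' L' : LusztigDatum} (h : IsMV R L) (h' : IsMV R' L') (p p' : ℕ)
    (hp : p' ≤ p) (hR' : R'.a = 0) (hL' : L'.a = Finsupp.single 0 p')
    (hR : R.a = R'.a + Finsupp.single 0 p) (hlam : R.lam = R'.lam) (hA : R.A = R'.A) :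
    R.a = Finsupp.single 0 p ∧ L.a = 0 := by
  have hRa : R.a = Finsupp.single 0 p := by rw [hR, hR', zero_add]
  refine ⟨hRa, ?_⟩
  by_contra hne
  have hc0 : Compat (EE R.a) (EE 0) := by
    rw [hRa]
    exact (compat_single p).symm
  have hcmp := compare hc0 h.lo (Ne.symm hne)
  rw [hRa, QQ_single, SS_single, SS_zero, QQ_zero] at hcmp
  have hSL := SS_nonneg L.a
  have hQL := QQ_nonneg L.a
  have hpp : (p' : ℤ) ≤ p := by exact_mod_cast hp
  have c1 := h.cl1
  have c2 := h.cl2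
  have d1 := h'.cl1
  have d2 := h'.cl2
  rw [hRa, QQ_single] at c1
  rw [hRa, QQ_single, SS_single] at c2
  rw [hR', hL', QQ_single, SS_single, QQ_zero] at d1
  rw [hR', hL', QQ_single, SS_zero, QQ_zero] at d2
  rcases hcmp with ⟨hlt, hq, _⟩ | ⟨hlt, _⟩
  · rcases h.hi.limit with hx | hy
    · have hm := min_width h.hi (by rw [hA]; exact h'.hi) hx
      rw [hA] at *
      linarith
    · have hsum : (R.lam.sum : ℤ) = L.lam.sum + (p + SS L.a) := by linarith
      have hparts := h.parts
      rw [hRa, SS_single] at hparts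
      rcases hparts with he | ⟨n, hn, he | he⟩
      · rw [he] at hsum
        linarith
      · have hmem : n ∈ R'.lam := by rw [← hlam, he]; simp
        have := h'.sizeR n hmem
        rw [hR', hL', SS_zero, SS_single] at this
        linarith
      · rw [he, Multiset.sum_cons] at hsum
        push_cast at hsum
        linarith
  · linarith

/-! ### Words -/

/-- Nonempty words, as an inductive predicate. -/
inductive Word : ZMod 2 → ℕ → MVPolytope → Prop
  | base (i : ZMod 2) (p : ℕ) (P Q : MVPolytope) (hp : 0 < p) (hQ : IsTrivialMV Q)
      (hf : MVf i p Q P) : Word i p P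
  | step (i : ZMod 2) (p p' : ℕ) (P Q : MVPolytope) (hp : 0 < p) (hpp : p' ≤ p)
      (hQ : Word (i + 1) p' Q) (hf : MVf i p Q P) : Word i p P

theorem exists_of_word {i : ZMod 2} {p : ℕ} {P : MVPolytope} (h : Word i p P) :
    ∃ (t : ℕ) (k : ℕ → ℕ) (s : ℕ → ZMod 2), k 0 = p ∧ s 0 = i ∧
        (∀ j, j + 1 < t → k (j + 1) ≤ k j) ∧
        (∀ j, j < t → 0 < k j) ∧
        (∀ j, j + 1 < t → s (j + 1) = s j + 1) ∧
        FWordChain t k s P := by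
  induction h with
  | base i p P Q hp hQ hf =>
    refine ⟨1, fun _ => p, fun _ => i, rfl, rfl, fun j hj => le_rfl, fun _ _ => hp,
      fun j hj => absurd hj (by omega), fun j => Nat.casesOn j P (fun _ => Q), hQ, rfl, ?_⟩
    intro j hj
    obtain rfl : j = 0 := by omega
    exact hf
  | step i p p' P Q hp hpp hQ hf ih =>
    obtain ⟨t, k, s, hk0, hs0, h1, h2, h3, q, hq1, hq2, hq3⟩ := ih
    refine ⟨t + 1, fun j => Nat.casesOn j p k, fun j => Nat.casesOn j i s, rfl, rfl, ?_, ?_, ?_,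
      fun j => Nat.casesOn j P q, hq1, rfl, ?_⟩
    · intro j hj
      cases j with
      | zero => show k 0 ≤ p; rw [hk0]; exact hpp
      | succ j => exact h1 j (by omega)
    · intro j hj
      cases j with
      | zero => exact hp
      | succ j => exact h2 j (by omega)
    · intro j hj
      cases j with
      | zero => exact hs0
      | succ j => exact h3 j (by omega)
    · intro j hj
      cases j with
      | zero => show MVf i p (q 0) P; rw [hq2]; exact hf
      | succ j => exact hq3 j (by omega)

theorem word_of_exists (t : ℕ) : ∀ (k : ℕ → ℕ) (s : ℕ → ZMod 2) (P : MVPolytope),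
    (∀ j, j + 1 < t + 1 → k (j + 1) ≤ k j) →
    (∀ j, j < t + 1 → 0 < k j) →
    (∀ j, j + 1 < t + 1 → s (j + 1) = s j + 1) →
    FWordChain (t + 1) k s P → Word (s 0) (k 0) P := by
  induction t with
  | zero =>
    rintro k s P h1 h2 h3 ⟨q, hq1, rfl, hq3⟩
    exact Word.base _ _ _ (q 1) (h2 0 (by omega)) hq1 (hq3 0 (by omega))
  | succ t ih =>
    rintro k s P h1 h2 h3 ⟨q, hq1, rfl, hq3⟩
    have := ih (fun j => k (j + 1)) (fun j => s (j + 1)) (q 1)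
      (fun j hj => h1 (j + 1) (by omega)) (fun j hj => h2 (j + 1) (by omega))
      (fun j hj => h3 (j + 1) (by omega))
      ⟨fun j => q (j + 1), hq1, rfl, fun j hj => hq3 (j + 1) (by omega)⟩
    rw [h3 0 (by omega)] at this
    exact Word.step _ _ _ _ (q 1) (h2 0 (by omega)) (h1 0 (by omega)) this (hq3 0 (by omega))

def HasType (i : ZMod 2) (p : ℕ) (P : MVPolytope) : Prop :=
  if i = 1 then P.R.a = Finsupp.single 0 p ∧ P.L.a = 0
  else P.L.a = Finsupp.single 0 p ∧ P.R.a = 0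

theorem zmod2_cases (i : ZMod 2) : i = 0 ∨ i = 1 := by
  revert i
  decide

theorem type_step (i : ZMod 2) (p p' : ℕ) (P Q : MVPolytope) (hp : p' ≤ p)
    (hQ : HasType (i + 1) p' Q) (hf : MVf i p Q P) : HasType i p P := by
  rcases zmod2_cases i with rfl | rfl
  · simp only [HasType, MVf, zero_add, zero_ne_one, if_true, if_false] at *
    exact step_up P.isMV.symm Q.isMV.symm p p' hp hQ.2 hQ.1 hf.1 hf.2.1 hf.2.2
  · have e : (1 + 1 : ZMod 2) = 0 := by decide
    simp only [HasType, MVf, e, zero_ne_one, if_true, if_false] at *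
    exact step_up P.isMV Q.isMV p p' hp hQ.2 hQ.1 hf.1 hf.2.1 hf.2.2

theorem type_of_word {i : ZMod 2} {p : ℕ} {P : MVPolytope} (h : Word i p P) :
    HasType i p P := by
  induction h with
  | base i p P Q hp hQ hf =>
    refine type_step i p 0 P Q (Nat.zero_le _) ?_ hf
    unfold HasType
    obtain ⟨h1, _, _, h2, _⟩ := hQ
    split_ifs
    · exact ⟨by rw [h1, Finsupp.single_zero], h2⟩
    · exact ⟨by rw [h2, Finsupp.single_zero], h1⟩
  | step i p p' P Q hp hpp hQ hf ih => exact type_step i p p' P Q hpp ih hf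

theorem trivial_of_zero {R L : LusztigDatum} (h : IsMV R L) (hR : R.a = 0) (hL : L.a = 0) :
    R.lam = 0 ∧ R.A = 0 ∧ L.lam = 0 ∧ L.A = 0 := by
  have c1 := h.cl1
  have c2 := h.cl2
  have s1 := h.sizeR
  have s2 := h.sizeL
  rw [hR, hL, SS_zero, QQ_zero] at c1 c2
  rw [hR, hL, SS_zero, add_zero] at s1 s2
  have n1 := SS_nonneg R.A
  have n2 := SS_nonneg L.A
  refine ⟨?_, eq_zero_of_SS (by linarith), ?_, eq_zero_of_SS (by linarith)⟩
  · apply Multiset.eq_zero_of_forall_notMem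
    intro x hx
    have h1 := R.lam_pos x hx
    have h2 := s1 x hx
    omega
  · apply Multiset.eq_zero_of_forall_notMem
    intro x hx
    have h1 := L.lam_pos x hx
    have h2 := s2 x hx
    omega

def tot (d : LusztigDatum) : ℤ := 2 * QQ d.a + SS d.a + 2 * d.lam.sum + 2 * QQ d.A + SS d.A

theorem tot_nonneg (d : LusztigDatum) : 0 ≤ tot d := by
  unfold tot
  have := SS_nonneg d.a
  have := QQ_nonneg d.a
  have := SS_nonneg d.A
  have := QQ_nonneg d.A
  positivity

theorem IsMV.tot_eq {R L : LusztigDatum} (h : IsMV R L) : tot R = tot L := by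
  unfold tot
  have := h.cl1
  have := h.cl2
  linarith

theorem tot_lower {R R' : LusztigDatum} (p : ℕ) (h : R.a = Finsupp.single 0 p) (h' : R'.a = 0)
    (hl : R'.lam = R.lam) (hA : R'.A = R.A) : tot R' = tot R - p := by
  unfold tot
  rw [h, h', hl, hA, SS_zero, QQ_zero, SS_single, QQ_single]
  ring

theorem word_of_type (N : ℕ) : ∀ (i : ZMod 2) (p : ℕ) (P : MVPolytope), tot P.R ≤ N → 0 < p →
    HasType i p P → Word i p P := by
  induction N with
  | zero =>
    intro i p P hN hp hT
    exfalso
    have hp' : (0 : ℤ) < p := by exact_mod_cast hp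
    push_cast at hN
    have e := P.isMV.tot_eq
    have key : ∀ d : LusztigDatum, d.a = Finsupp.single 0 p → 0 < tot d := by
      intro d hd
      unfold tot
      rw [hd, SS_single, QQ_single]
      have := SS_nonneg d.A
      have := QQ_nonneg d.A
      positivity
    unfold HasType at hT
    split_ifs at hT
    · have := key _ hT.1; linarith
    · have := key _ hT.1; linarith
  | succ N ih =>
    intro i p P hN hp hT
    have hp' : (1 : ℤ) ≤ p := by exact_mod_cast hp
    push_cast at hN
    rcases zmod2_cases i with rfl | rfl
    · simp only [HasType, zero_ne_one, if_false] at hT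
      obtain ⟨R', L', w, hw, hMV, h1, h2, h3, h4⟩ := step_down P.isMV.symm p hT.1 hT.2
      obtain ⟨Q, hQR, hQL⟩ := hMV.symm.toPoly
      have hf : MVf 0 p Q P := by
        simp only [MVf, zero_ne_one, if_false]
        rw [hQL, h1, h2, h3, zero_add]
        exact ⟨hT.1, rfl, rfl⟩
      have ht := tot_lower p hT.1 h1 h2 h3
      have ht1 := P.isMV.tot_eq
      have ht2 := Q.isMV.tot_eq
      rw [hQL] at ht2
      rcases Nat.eq_zero_or_pos w with rfl | hwp
      · rw [Finsupp.single_zero] at h4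
        obtain ⟨t1, t2, t3, t4⟩ := trivial_of_zero hMV h1 h4
        refine Word.base _ _ _ Q hp ?_ hf
        unfold IsTrivialMV
        rw [hQR, hQL]
        exact ⟨h4, t3, t4, h1, t1, t2⟩
      · refine Word.step _ _ w _ Q hp hw (ih _ w Q (by linarith) hwp ?_) hf
        simp only [HasType, zero_add, if_true]
        rw [hQR, hQL]
        exact ⟨h4, h1⟩
    · simp only [HasType, if_true] at hT
      obtain ⟨R', L', w, hw, hMV, h1, h2, h3, h4⟩ := step_down P.isMV p hT.1 hT.2
      obtain ⟨Q, hQR, hQL⟩ := hMV.toPoly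
      have hf : MVf 1 p Q P := by
        simp only [MVf, if_true]
        rw [hQR, h1, h2, h3, zero_add]
        exact ⟨hT.1, rfl, rfl⟩
      have ht := tot_lower p hT.1 h1 h2 h3
      rw [← hQR] at ht
      rcases Nat.eq_zero_or_pos w with rfl | hwp
      · rw [Finsupp.single_zero] at h4
        obtain ⟨t1, t2, t3, t4⟩ := trivial_of_zero hMV h1 h4
        refine Word.base _ _ _ Q hp ?_ hf
        unfold IsTrivialMV
        rw [hQR, hQL]
        exact ⟨h1, t1, t2, h4, t3, t4⟩
      · refine Word.step _ _ w _ Q hp hw (ih _ w Q (by linarith) hwp ?_) hf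
        have e : (1 + 1 : ZMod 2) = 0 := by decide
        simp only [HasType, e, zero_ne_one, if_false]
        rw [hQR, hQL]
        exact ⟨h4, h1⟩

theorem eq_single_of {a : ℕ →₀ ℕ} (h : ∀ k, 1 ≤ k → a k = 0) :
    a = Finsupp.single 0 (a 0) := by
  ext k
  by_cases hk : k = 0
  · subst hk; simp
  · rw [h k (by omega), Finsupp.single_eq_of_ne hk]

theorem deltaTop_of_type {i : ZMod 2} {p : ℕ} {P : MVPolytope} (h : HasType i p P) :
    IsDeltaTopMV P := by
  unfold HasType at h
  split_ifs at h
  · exact ⟨fun k hk => by rw [h.1, Finsupp.single_eq_of_ne (by omega)],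
      fun k _ => by rw [h.2]; rfl⟩
  · exact ⟨fun k _ => by rw [h.2]; rfl,
      fun k hk => by rw [h.1, Finsupp.single_eq_of_ne (by omega)]⟩

/-- `P` is a δ-top polytope iff `P = f_{i_1}^{k_1} ⋯ f_{i_t}^{k_t}(P₀)` for
some weakly decreasing positive exponents and alternating indices in `ℤ/2ℤ`. -/
theorem isDeltaTopMV_iff_word (P : MVPolytope) :
    IsDeltaTopMV P ↔
      ∃ (t : ℕ) (k : ℕ → ℕ) (i : ℕ → ZMod 2),
        (∀ j, j + 1 < t → k (j + 1) ≤ k j) ∧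
        (∀ j, j < t → 0 < k j) ∧
        (∀ j, j + 1 < t → i (j + 1) = i j + 1) ∧
        FWordChain t k i P := by
  constructor
  · rintro ⟨hR, hL⟩
    have eR := eq_single_of hR
    have eL := eq_single_of hL
    have hzero : P.R.a 0 = 0 ∨ P.L.a 0 = 0 := by
      have h := (P.isMV.lo 0).2.2
      rw [eR, eL] at h
      unfold EX EY at h
      simp only [EE_single] at h
      push_cast at h
      rcases h with h | h
      · right; omega
      · left; omega
    have main : ∀ (i : ZMod 2) (p : ℕ), 0 < p → HasType i p P → ∃ (t : ℕ) (k : ℕ → ℕ)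
        (i : ℕ → ZMod 2),
        (∀ j, j + 1 < t → k (j + 1) ≤ k j) ∧
        (∀ j, j < t → 0 < k j) ∧
        (∀ j, j + 1 < t → i (j + 1) = i j + 1) ∧
        FWordChain t k i P := by
      intro i p hp hT
      have hW := word_of_type (tot P.R).toNat i p P (Int.self_le_toNat _) hp hT
      obtain ⟨t, k, s, -, -, h⟩ := exists_of_word hW
      exact ⟨t, k, s, h⟩
    rcases Nat.eq_zero_or_pos (P.R.a 0) with hp | hp
    · rcases Nat.eq_zero_or_pos (P.L.a 0) with hq | hq
      · rw [hp, Finsupp.single_zero] at eR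
        rw [hq, Finsupp.single_zero] at eL
        obtain ⟨t1, t2, t3, t4⟩ := trivial_of_zero P.isMV eR eL
        exact ⟨0, fun _ => 0, fun _ => 0, fun j hj => absurd hj (by omega),
          fun j hj => absurd hj (by omega), fun j hj => absurd hj (by omega), fun _ => P,
          ⟨eR, t1, t2, eL, t3, t4⟩, rfl, fun j hj => absurd hj (by omega)⟩
      · refine main 0 _ hq ?_
        simp only [HasType, zero_ne_one, if_false]
        exact ⟨eL, by rw [eR, hp, Finsupp.single_zero]⟩
    · refine main 1 _ hp ?_
      simp only [HasType, if_true]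
      exact ⟨eR, by rw [eL, hzero.resolve_left hp.ne', Finsupp.single_zero]⟩
  · rintro ⟨t, k, s, h1, h2, h3, h4⟩
    cases t with
    | zero =>
      obtain ⟨q, hq, rfl, -⟩ := h4
      obtain ⟨e1, _, _, e2, _⟩ := hq
      exact ⟨fun k _ => by rw [e1]; rfl, fun k _ => by rw [e2]; rfl⟩
    | succ t => exact deltaTop_of_type (type_of_word (word_of_exists t k s P h1 h2 h3 h4))

end MVPaper
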